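/- (Lemma 5.) Let G ⊆ ℕ be a nonempty finite set, let Y ∈ ℕ with 1 ≤ Y ≤ |G|, let μ₁, μ₂ : ℕ → ℝ take values in [0,1] on G, and let H > 0 be real. Let B and M be real numbers with B · M ≥ |G| · C(|G| − 1, Y − 1), where C(n, k) is the binomial coefficient. If S(μ₁, G, Y) ≥ S(μ₂, G, Y) + H, then there exists ν ∈ G such that μ₁(ν) ≥ μ₂(ν) + H/(B·M). -/

import Mathlib

/-- Success probability: probability that at least `Y` devices in `A` succeed. -/
noncomputable def S (μ : ℕ → ℝ) (A : Finset ℕ) (Y : ℕ) : ℝ :=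
  ∑ A' ∈ A.powerset.filter (fun A' => Y ≤ A'.card),
    (∏ ν ∈ A', μ ν) * (∏ ν ∈ A \ A', (1 - μ ν))

theorem S_empty (μ : ℕ → ℝ) (Y : ℕ) : S μ ∅ Y = if Y = 0 then 1 else 0 := by
  simp [S, Finset.sum_filter]

/-- Conditioning the success probability on the outcome of a single device. -/
theorem S_insert (μ : ℕ → ℝ) {a : ℕ} {A : Finset ℕ} (ha : a ∉ A) (Y : ℕ) :
    S μ (insert a A) Y = μ a * S μ A (Y - 1) + (1 - μ a) * S μ A Y := by
  simp only [S, Finset.sum_filter]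
  rw [Finset.sum_powerset_insert ha, add_comm, Finset.mul_sum, Finset.mul_sum]
  congr 1
  · refine Finset.sum_congr rfl fun t ht => ?_
    have hat : a ∉ t := fun h => ha (Finset.mem_powerset.1 ht h)
    have hsdiff : insert a A \ insert a t = A \ t := by
      ext x
      simp only [Finset.mem_sdiff, Finset.mem_insert]
      grind
    rw [Finset.card_insert_of_notMem hat, Finset.prod_insert hat, hsdiff, mul_ite, mul_zero,
      mul_assoc]
    exact if_congr (by omega) rfl rfl
  · refine Finset.sum_congr rfl fun t ht => ?_
    have hat : a ∉ t := fun h => ha (Finset.mem_powerset.1 ht h)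
    rw [Finset.insert_sdiff_of_notMem _ hat, Finset.prod_insert (by simp [ha]), mul_ite, mul_zero,
      mul_left_comm]

theorem S_le_one {μ : ℕ → ℝ} {A : Finset ℕ} (hμ : ∀ ν ∈ A, 0 ≤ μ ν ∧ μ ν ≤ 1) (Y : ℕ) :
    S μ A Y ≤ 1 := by
  induction A using Finset.induction_on generalizing Y with
  | empty => rw [S_empty]; split_ifs <;> norm_num
  | insert a A ha ih =>
    rw [Finset.forall_mem_insert] at hμ
    rw [S_insert μ ha]
    nlinarith [mul_le_mul_of_nonneg_left (ih hμ.2 (Y - 1)) hμ.1.1,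
      mul_le_mul_of_nonneg_left (ih hμ.2 Y) (sub_nonneg.2 hμ.1.2)]

theorem prod_mul_prod_sdiff_nonneg {μ : ℕ → ℝ} {A t : Finset ℕ}
    (hμ : ∀ ν ∈ A, 0 ≤ μ ν ∧ μ ν ≤ 1) (ht : t ⊆ A) :
    0 ≤ (∏ ν ∈ t, μ ν) * ∏ ν ∈ A \ t, (1 - μ ν) :=
  mul_nonneg (Finset.prod_nonneg fun ν hν => (hμ ν (ht hν)).1)
    (Finset.prod_nonneg fun ν hν => sub_nonneg.2 (hμ ν (Finset.mem_sdiff.1 hν).1).2)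

theorem S_nonneg {μ : ℕ → ℝ} {A : Finset ℕ} (hμ : ∀ ν ∈ A, 0 ≤ μ ν ∧ μ ν ≤ 1) (Y : ℕ) :
    0 ≤ S μ A Y := by
  exact Finset.sum_nonneg fun t ht =>
    prod_mul_prod_sdiff_nonneg hμ (Finset.mem_powerset.1 (Finset.mem_filter.1 ht).1)

theorem S_antitone {μ : ℕ → ℝ} {A : Finset ℕ} (hμ : ∀ ν ∈ A, 0 ≤ μ ν ∧ μ ν ≤ 1) :
    Antitone (S μ A) := by
  intro Y Z hYZ
  exact Finset.sum_le_sum_of_subset_of_nonneg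
    (Finset.monotone_filter_right _ fun t _ ht => hYZ.trans ht) fun t ht _ =>
    prod_mul_prod_sdiff_nonneg hμ (Finset.mem_powerset.1 (Finset.mem_filter.1 ht).1)

/-- The success probability is one-sidedly Lipschitz in the individual probabilities. -/
theorem S_sub_le_sum_max {μ₁ μ₂ : ℕ → ℝ} {A : Finset ℕ}
    (h₁ : ∀ ν ∈ A, 0 ≤ μ₁ ν ∧ μ₁ ν ≤ 1) (h₂ : ∀ ν ∈ A, 0 ≤ μ₂ ν ∧ μ₂ ν ≤ 1) (Y : ℕ) :
    S μ₁ A Y - S μ₂ A Y ≤ ∑ ν ∈ A, max 0 (μ₁ ν - μ₂ ν) := by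
  induction A using Finset.induction_on generalizing Y with
  | empty => simp [S_empty]
  | insert a A ha ih =>
    rw [Finset.forall_mem_insert] at h₁ h₂
    rw [S_insert μ₁ ha, S_insert μ₂ ha, Finset.sum_insert ha]
    have hgap : (μ₁ a - μ₂ a) * (S μ₂ A (Y - 1) - S μ₂ A Y) ≤ max 0 (μ₁ a - μ₂ a) := by
      have hnn := sub_nonneg.2 (S_antitone h₂.2 (Nat.sub_le Y 1))
      have hle : S μ₂ A (Y - 1) - S μ₂ A Y ≤ 1 := by
        linarith [S_le_one h₂.2 (Y - 1), S_nonneg h₂.2 Y]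
      exact (mul_le_mul_of_nonneg_right (le_max_right 0 _) hnn).trans
        (mul_le_of_le_one_right (le_max_left 0 _) hle)
    linarith [mul_le_mul_of_nonneg_left (ih h₁.2 h₂.2 (Y - 1)) h₁.1.1,
      mul_le_mul_of_nonneg_left (ih h₁.2 h₂.2 Y) (sub_nonneg.2 h₁.1.2)]

theorem stmt_10 (G : Finset ℕ) (hG : G.Nonempty) (Y : ℕ) (hY1 : 1 ≤ Y) (hY2 : Y ≤ G.card)
    (μ₁ μ₂ : ℕ → ℝ)
    (hb1 : ∀ ν ∈ G, 0 ≤ μ₁ ν ∧ μ₁ ν ≤ 1)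
    (hb2 : ∀ ν ∈ G, 0 ≤ μ₂ ν ∧ μ₂ ν ≤ 1)
    (H : ℝ) (hH : 0 < H) (B M : ℝ)
    (hBM : (G.card : ℝ) * (Nat.choose (G.card - 1) (Y - 1) : ℝ) ≤ B * M)
    (hS : S μ₁ G Y ≥ S μ₂ G Y + H) :
    ∃ ν ∈ G, μ₁ ν ≥ μ₂ ν + H / (B * M) := by
  have hcard : (0 : ℝ) < G.card := by exact_mod_cast hG.card_pos
  have hchoose : (1 : ℝ) ≤ Nat.choose (G.card - 1) (Y - 1) := by
    exact_mod_cast Nat.choose_pos (Nat.sub_le_sub_right hY2 1)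
  have hle : (G.card : ℝ) ≤ B * M := (le_mul_of_one_le_right hcard.le hchoose).trans hBM
  have hpos : 0 < H / (B * M) := div_pos hH (hcard.trans_le hle)
  by_contra! hlt
  have hsum : ∑ ν ∈ G, max 0 (μ₁ ν - μ₂ ν) < ∑ _ν ∈ G, H / (B * M) :=
    Finset.sum_lt_sum_of_nonempty hG fun ν hν => max_lt hpos (by linarith [hlt ν hν])
  rw [Finset.sum_const, nsmul_eq_mul] at hsum
  have hbound : G.card * (H / (B * M)) ≤ H := by
    rw [mul_div_left_comm]
    exact mul_le_of_le_one_right hH.le ((div_le_one (hcard.trans_le hle)).2 hle)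
  linarith [S_sub_le_sum_max hb1 hb2 Y]
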